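/- Let G be a finite chordal simple graph and let (C_1, …, C_k) and (C'_1, …, C'_k) be two perfect sequences of G, with separators S_j := C_j ∩ (C_1 ∪ … ∪ C_{j−1}) and S'_j := C'_j ∩ (C'_1 ∪ … ∪ C'_{j−1}) for 2 ≤ j ≤ k. Then the multisets {S_2, …, S_k} and {S'_2, …, S'_k} are equal; in particular, the number of times any given vertex set appears among S_2, …, S_k (its multiplicity) does not depend on the choice of perfect sequence. -/

import Mathlib

/-- A finite simple graph is chordal if every cycle of length at least 4 has a chord,
i.e., an edge of `G` joining two vertices of the cycle that are not consecutive on the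
cycle (equivalently, the edge is not an edge of the cycle). -/
def IsChordal {V : Type*} (G : SimpleGraph V) : Prop :=
  ∀ ⦃v : V⦄ (c : G.Walk v v), c.IsCycle → 4 ≤ c.length →
    ∃ u w, u ∈ c.support ∧ w ∈ c.support ∧ G.Adj u w ∧ s(u, w) ∉ c.edges

/-- A maximal clique: a clique not properly contained in any other clique. -/
def IsMaxClique {V : Type*} (G : SimpleGraph V) (s : Finset V) : Prop :=
  G.IsClique (s : Set V) ∧ ∀ t : Finset V, G.IsClique (t : Set V) → s ⊆ t → s = t

/-- The `j`-th separator of a sequence of cliques: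
`S j = C j ∩ (C 0 ∪ … ∪ C (j-1))`. -/
def sep {V : Type*} [DecidableEq V] {k : ℕ} (C : Fin k → Finset V) (j : Fin k) : Finset V :=
  C j ∩ (Finset.univ.filter (fun i : Fin k => i < j)).biUnion C

/-- A perfect sequence of `G`: an enumeration of all maximal cliques of `G` satisfying
the running intersection property. -/
def IsPerfectSeq {V : Type*} [DecidableEq V] (G : SimpleGraph V) {k : ℕ}
    (C : Fin k → Finset V) : Prop :=
  Function.Injective C ∧
  (∀ i : Fin k, IsMaxClique G (C i)) ∧
  (∀ s : Finset V, IsMaxClique G s → ∃ i : Fin k, C i = s) ∧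
  (∀ j : Fin k, 0 < (j : ℕ) → ∃ l : Fin k, l < j ∧ sep C j ⊆ C l)

/-- The multiset of separators `S j`, `0 < j`, of a sequence of cliques. -/
def seps {V : Type*} [DecidableEq V] {k : ℕ} (C : Fin k → Finset V) : Multiset (Finset V) :=
  (Finset.univ.filter (fun j : Fin k => 0 < (j : ℕ))).val.map (sep C)

/-- In a partial order, a multiset is determined by how many of its elements lie above each
given element. -/
theorem Multiset.eq_of_countP_le_eq {α : Type*} [PartialOrder α] [DecidableEq α]
    [DecidableLE α] (s t : Multiset α)
    (h : ∀ a, s.countP (a ≤ ·) = t.countP (a ≤ ·)) : s = t := by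
  induction hn : s.card generalizing s t with
  | zero =>
    obtain rfl := Multiset.card_eq_zero.mp hn
    symm
    refine Multiset.eq_zero_of_forall_notMem fun a ha => ?_
    have hpos : 0 < t.countP (a ≤ ·) := Multiset.countP_pos.mpr ⟨a, ha, le_rfl⟩
    simp [← h a] at hpos
  | succ n ih =>
    have hne : s.toFinset.Nonempty := by
      rw [Multiset.toFinset_nonempty]
      rintro rfl
      simp at hn
    obtain ⟨a, hmax⟩ := s.toFinset.exists_maximal hne
    have ha : a ∈ s := Multiset.mem_toFinset.mp hmax.1
    have hat : a ∈ t := by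
      obtain ⟨b, hb, hab⟩ := Multiset.countP_pos.mp
        (h a ▸ Multiset.countP_pos.mpr ⟨a, ha, le_rfl⟩)
      obtain ⟨c, hc, hbc⟩ := Multiset.countP_pos.mp
        ((h b).symm ▸ Multiset.countP_pos.mpr ⟨b, hb, le_rfl⟩)
      have hca : c ≤ a := hmax.2 (Multiset.mem_toFinset.mpr hc) (hab.trans hbc)
      rwa [le_antisymm hab (hbc.trans hca)]
    obtain ⟨s', rfl⟩ := Multiset.exists_cons_of_mem ha
    obtain ⟨t', rfl⟩ := Multiset.exists_cons_of_mem hat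
    rw [ih s' t' (fun b => ?_) (by simpa using hn)]
    have hb := h b
    simp only [Multiset.countP_cons] at hb
    omega

/-- A set contained in `C j` is contained in the `j`-th separator iff `C j` is not the first
clique of the sequence containing it. -/
theorem IsPerfectSeq.subset_sep_iff {V : Type*} [DecidableEq V] {G : SimpleGraph V} {k : ℕ}
    {C : Fin k → Finset V} (hC : IsPerfectSeq G C) (T : Finset V) (j : Fin k) :
    (0 < (j : ℕ) ∧ T ⊆ sep C j) ↔ T ⊆ C j ∧ ∃ l < j, T ⊆ C l := by
  constructor
  · rintro ⟨hj, hT⟩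
    obtain ⟨l, hl, hsub⟩ := hC.2.2.2 j hj
    exact ⟨hT.trans Finset.inter_subset_left, l, hl, hT.trans hsub⟩
  · rintro ⟨hT, l, hl, hTl⟩
    refine ⟨Nat.zero_lt_of_lt hl, Finset.subset_inter hT (hTl.trans ?_)⟩
    exact Finset.subset_biUnion_of_mem C (by simpa using hl)

/-- The number of separators containing `T` is one less than the number of maximal cliques
containing `T`, with truncated subtraction. -/
theorem IsPerfectSeq.countP_subset_seps {V : Type*} [DecidableEq V] {G : SimpleGraph V} {k : ℕ}
    {C : Fin k → Finset V} (hC : IsPerfectSeq G C) (T : Finset V) :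
    (seps C).countP (T ≤ ·) = ((Finset.univ.image C).filter (T ⊆ ·)).card - 1 := by
  have hcount : (seps C).countP (T ≤ ·) =
      (Finset.univ.filter fun j : Fin k => T ⊆ C j ∧ ∃ l < j, T ⊆ C l).card := by
    simp only [← hC.subset_sep_iff T]
    rw [seps, Multiset.countP_map, ← Finset.filter_val, Finset.card_val, Finset.filter_filter]
  rw [hcount, Finset.filter_image, Finset.card_image_of_injective _ hC.1]
  set A := Finset.univ.filter fun j : Fin k => T ⊆ C j with hA
  rcases A.eq_empty_or_nonempty with hempty | hne
  · rw [hempty, Finset.card_empty, Finset.card_eq_zero, ← Finset.subset_empty, ← hempty]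
    exact Finset.monotone_filter_right _ fun _ _ hj => hj.1
  · rw [← Finset.card_erase_of_mem (A.min'_mem hne)]
    congr 1
    ext j
    simp only [Finset.mem_filter, Finset.mem_univ, true_and, Finset.mem_erase]
    constructor
    · rintro ⟨hj, l, hl, hTl⟩
      have hmin := A.min'_le l (by simpa [hA] using hTl)
      exact ⟨(hmin.trans_lt hl).ne', by simpa [hA] using hj⟩
    · rintro ⟨hj, hjA⟩
      have hmem := A.min'_mem hne
      exact ⟨(Finset.mem_filter.mp hjA).2, A.min' hne,
        lt_of_le_of_ne (A.min'_le j hjA) (Ne.symm hj), (Finset.mem_filter.mp hmem).2⟩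

/-- The members of a perfect sequence are exactly the maximal cliques. -/
theorem IsPerfectSeq.mem_image_iff {V : Type*} [DecidableEq V] {G : SimpleGraph V} {k : ℕ}
    {C : Fin k → Finset V} (hC : IsPerfectSeq G C) (s : Finset V) :
    s ∈ Finset.univ.image C ↔ IsMaxClique G s := by
  simp only [Finset.mem_image, Finset.mem_univ, true_and]
  exact ⟨fun ⟨i, hi⟩ => hi ▸ hC.2.1 i, hC.2.2.1 s⟩

/-- For a finite chordal simple graph, any two perfect sequences give rise to the same
multiset of separators; in particular the multiplicity of any given vertex set among the
separators does not depend on the choice of the perfect sequence. -/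
theorem stmt5 {V : Type*} [Fintype V] [DecidableEq V] (G : SimpleGraph V)
    (hG : IsChordal G) {k : ℕ} (C C' : Fin k → Finset V)
    (hC : IsPerfectSeq G C) (hC' : IsPerfectSeq G C') :
    seps C = seps C' ∧ ∀ S : Finset V, (seps C).count S = (seps C').count S := by
  have himage : Finset.univ.image C = Finset.univ.image C' := by
    ext s
    rw [hC.mem_image_iff, hC'.mem_image_iff]
  have heq : seps C = seps C' := Multiset.eq_of_countP_le_eq _ _ fun T => by
    rw [hC.countP_subset_seps, hC'.countP_subset_seps, himage]
  exact ⟨heq, fun S => by rw [heq]⟩
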